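/- Let F be an algebraically closed field of characteristic zero and let L be a Lie algebra over F. Assume that for every finite subset S of L there exist a finite-dimensional semisimple Lie subalgebra H of L with S ⊆ H and an F-linear map π : L → L with π x ∈ H for all x ∈ L and π x = x for all x ∈ H, such that for every derivation D of L the map H → H given by x ↦ π(D x) is a derivation of H. Then every local derivation of L is a derivation. -/

import Mathlib

set_option maxHeartbeats 1000000
set_option synthInstance.maxHeartbeats 1000000

namespace LocDer
open LieAlgebra LieModule Module

section
variable {F L : Type*} [Field F] [CharZero F] [LieRing L] [LieAlgebra F L]

/-- Exponentials of `t • ad z` preserve commuting pairs. -/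
lemma exp_comm (z : L) (N : ℕ) (hN : (LieAlgebra.ad F L z) ^ N = 0) (t : F) (x y : L)
    (hxy : ⁅x, y⁆ = 0) :
    ⁅∑ k ∈ Finset.range N, (t ^ k * (k.factorial : F)⁻¹) • ((LieAlgebra.ad F L z) ^ k) x,
      ∑ k ∈ Finset.range N, (t ^ k * (k.factorial : F)⁻¹) • ((LieAlgebra.ad F L z) ^ k) y⁆ = 0 := by
  let _i : Module ℚ L := Module.compHom L (algebraMap ℚ F)
  let _j : LieAlgebra ℚ L := { lie_smul := fun q a b => lie_smul ((algebraMap ℚ F) q) a b }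
  let D : LieDerivation F L L := LieDerivation.ad F L (t • z)
  have hD : D.toLinearMap = t • LieAlgebra.ad F L z := by
    ext v; simp [D]
  have hDN : D.toLinearMap ^ N = 0 := by rw [hD, smul_pow, hN, smul_zero]
  have hnil : _root_.IsNilpotent D.toLinearMap := ⟨N, hDN⟩
  have key : ∀ v, LieDerivation.exp D hnil v =
      ∑ k ∈ Finset.range N, (t ^ k * (k.factorial : F)⁻¹) • ((LieAlgebra.ad F L z) ^ k) v := by
    intro v
    rw [LieDerivation.exp_map_apply, IsNilpotent.exp_eq_sum hDN, LinearMap.sum_apply]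
    refine Finset.sum_congr rfl fun k _ => ?_
    rw [hD, smul_pow, LinearMap.smul_apply, LinearMap.smul_apply, ← Rat.cast_smul_eq_qsmul F,
      smul_smul, mul_comm]
    simp
  rw [← key, ← key, ← LieEquiv.map_lie, hxy, map_zero]

lemma invariance (B : L →ₗ[F] L →ₗ[F] F) (hB : ∀ x y : L, ⁅x, y⁆ = 0 → B x y = 0)
    (z : L) (hz : IsNilpotent (LieAlgebra.ad F L z)) (x y : L) (hxy : ⁅x, y⁆ = 0) :
    B ⁅z, x⁆ y + B x ⁅z, y⁆ = 0 := by
  obtain ⟨M, hM⟩ := hz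
  have hN : (LieAlgebra.ad F L z) ^ (M + 2) = 0 := by rw [pow_add, hM, zero_mul]
  let c : ℕ → ℕ → F := fun j k => (j.factorial : F)⁻¹ * (k.factorial : F)⁻¹ *
    B (((LieAlgebra.ad F L z) ^ j) x) (((LieAlgebra.ad F L z) ^ k) y)
  let p : Polynomial F := ∑ j ∈ Finset.range (M + 2), ∑ k ∈ Finset.range (M + 2),
    Polynomial.monomial (j + k) (c j k)
  have hp : p = 0 := by
    apply Polynomial.funext
    intro t
    have := hB _ _ (exp_comm z (M + 2) hN t x y hxy)
    simp only [map_sum, LinearMap.sum_apply, map_smul, LinearMap.smul_apply, smul_eq_mul,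
      Finset.mul_sum] at this
    simp only [p, Polynomial.eval_finsetSum, Polynomial.eval_monomial, Polynomial.eval_zero, c]
    refine Eq.trans ?_ this
    rw [Finset.sum_comm]
    refine Finset.sum_congr rfl fun j _ => ?_
    refine Finset.sum_congr rfl fun k _ => ?_
    ring
  have h1 : p.coeff 1 = c 1 0 + c 0 1 := by
    simp only [p, Polynomial.finsetSum_coeff, Polynomial.coeff_monomial]
    rw [Finset.sum_range_succ', Finset.sum_range_succ']
    rw [Finset.sum_eq_zero]
    · congr 1
      · rw [zero_add, Finset.sum_range_succ', Finset.sum_eq_zero]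
        · simp
        · intro k _
          rw [if_neg (by omega)]
      · rw [Finset.sum_range_succ', Finset.sum_range_succ', Finset.sum_eq_zero]
        · simp
        · intro k _
          rw [if_neg (by omega)]
    · intro j _
      apply Finset.sum_eq_zero
      intro k _
      rw [if_neg (by omega)]
  rw [hp] at h1
  simpa [c] using h1.symm

/-- Weak form of being a local derivation. -/
def IsLoc (Δ : L →ₗ[F] L) : Prop := ∀ x y : L, ⁅x, y⁆ = 0 → killingForm F L (Δ x) y = 0

lemma isLoc_ad (a : L) : IsLoc (F := F) (LieAlgebra.ad F L a) := by
  intro x y h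
  rw [LieAlgebra.ad_apply, killingForm, traceForm_apply_lie_apply, h, map_zero]

lemma IsLoc.add {Δ Δ' : L →ₗ[F] L} (h : IsLoc Δ) (h' : IsLoc Δ') : IsLoc (Δ + Δ') := by
  intro x y hxy
  rw [LinearMap.add_apply, map_add, LinearMap.add_apply, h x y hxy, h' x y hxy, add_zero]

lemma IsLoc.inv {Δ : L →ₗ[F] L} (h : IsLoc Δ) (z : L) (hz : IsNilpotent (LieAlgebra.ad F L z))
    (x y : L) (hxy : ⁅x, y⁆ = 0) :
    killingForm F L (Δ ⁅z, x⁆) y + killingForm F L (Δ x) ⁅z, y⁆ = 0 :=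
  invariance ((killingForm F L) ∘ₗ Δ) (fun a b hab => h a b hab) z hz x y hxy

lemma IsLoc.comm {Δ : L →ₗ[F] L} (h : IsLoc Δ) (z : L) (hz : IsNilpotent (LieAlgebra.ad F L z)) :
    IsLoc ((LieAlgebra.ad F L z) ∘ₗ Δ - Δ ∘ₗ (LieAlgebra.ad F L z)) := by
  intro x y hxy
  have := h.inv z hz x y hxy
  simp only [LinearMap.sub_apply, LinearMap.comp_apply, LieAlgebra.ad_apply, map_sub]
  rw [killingForm, traceForm_apply_lie_apply']
  rw [killingForm] at this
  linear_combination -this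
end

section
variable {K L : Type*} [Field K] [CharZero K] [LieRing L] [LieAlgebra K L]
  [IsKilling K L] [FiniteDimensional K L]
  {H : LieSubalgebra K L} [H.IsCartanSubalgebra] [IsTriangularizable K H L]

lemma weight_ind {p : L → Prop} (h0 : p 0) (hadd : ∀ x y, p x → p y → p (x + y))
    (hw : ∀ (α : Weight K H L) (x : L), x ∈ rootSpace H α → p x) (x : L) : p x := by
  have hx : x ∈ ⨆ χ : Weight K H L, genWeightSpace L χ := by
    simp [iSup_genWeightSpace_eq_top' K H L]
  induction hx using LieSubmodule.iSup_induction' with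
  | zero => exact h0
  | mem χ m hm => exact hw χ m hm
  | add a b _ _ ha hb => exact hadd a b ha hb

lemma eq_zero_of_orth (v : L)
    (h : ∀ (α : Weight K H L) (y : L), y ∈ rootSpace H α → killingForm K L v y = 0) : v = 0 := by
  have h2 : killingForm K L v = 0 := by
    ext y
    refine weight_ind (H := H) (p := fun y => killingForm K L v y = (0 : L →ₗ[K] K) y)
      (by simp) (fun a b ha hb => ?_) (fun α y hy => ?_) y
    · rw [map_add, ha, hb, map_add]
    · simpa using h α y hy
  have h3 : v ∈ LinearMap.ker (killingForm K L) := h2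
  rwa [IsKilling.ker_killingForm_eq_bot, Submodule.mem_bot] at h3

lemma zero_or_mem {α : Weight K H L} (hα : α.IsZero) {x : L} (hx : x ∈ rootSpace H α) : x ∈ H := by
  rw [show (α : H → K) = 0 from hα, rootSpace_zero_eq] at hx
  exact hx

lemma lie_root {α : H → K} {x : L} (hx : x ∈ rootSpace H α) (h : H) :
    ⁅(h : L), x⁆ = α h • x := IsKilling.lie_eq_smul_of_mem_rootSpace hx h

lemma exists_sep (α β : Weight K H L) (hβ : β.IsNonZero) (h1 : β ≠ α) (h2 : β ≠ -α) :
    ∃ h : H, α h = 0 ∧ β h ≠ 0 := by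
  by_contra! hc
  have : Weight.toLinear K H L β ∈ Submodule.span K (Set.range (fun _ : Unit => Weight.toLinear K H L α)) := by
    apply mem_span_of_iInf_ker_le_ker
    intro h hh
    simp only [iInf_const, LinearMap.mem_ker, Weight.toLinear_apply] at hh ⊢
    exact hc h hh
  rw [Set.range_const, Submodule.mem_span_singleton] at this
  obtain ⟨k, hk⟩ := this
  rcases IsKilling.eq_neg_or_eq_of_eq_smul α β hβ k (by
    funext h
    have := LinearMap.congr_fun hk h
    simpa using this.symm) with h | h
  · exact h2 h
  · exact h1 h

lemma preserves {Δ : L →ₗ[K] L} (hΔ : IsLoc Δ) (hH : ∀ h ∈ H, Δ h = 0) (β : Weight K H L)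
    {e : L} (he : e ∈ rootSpace H β) : Δ e ∈ rootSpace H β := by
  by_cases hβ : β.IsZero
  · rw [hH e (zero_or_mem hβ he)]; exact zero_mem _
  have horth : ∀ (α : Weight K H L) (y : L), y ∈ rootSpace H α → α ≠ -β →
      killingForm K L (Δ e) y = 0 := by
    intro α y hy hαβ
    by_cases hab : β = α
    · subst hab
      by_cases he0 : e = 0
      · simp [he0]
      have h1 := IsKilling.finrank_rootSpace_eq_one β hβ
      have hne : (⟨e, he⟩ : rootSpace H β) ≠ 0 := by simpa [Subtype.ext_iff] using he0
      obtain ⟨c, hc⟩ := (finrank_eq_one_iff_of_nonzero' _ hne).mp h1 ⟨y, hy⟩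
      have hc' : c • e = y := congrArg Subtype.val hc
      rw [← hc']
      apply hΔ
      simp
    · obtain ⟨h, h0, hne⟩ := exists_sep α β hβ hab (fun h => hαβ (by rw [h, neg_neg]))
      have hn := LieAlgebra.isNilpotent_ad_of_mem_rootSpace H (χ := β) hβ he
      have := hΔ.inv e hn (h : L) y (by rw [lie_root hy, h0, zero_smul])
      rw [hH h h.2, ← lie_skew, lie_root he] at this
      simp only [map_neg, map_smul, LinearMap.neg_apply, LinearMap.smul_apply, smul_eq_mul,
        map_zero, LinearMap.zero_apply, add_zero, neg_eq_zero, mul_eq_zero] at this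
      exact this.resolve_left hne
  apply weightSpace_le_genWeightSpace
  rw [mem_weightSpace]
  intro h
  rw [← sub_eq_zero]
  apply eq_zero_of_orth (H := H)
  intro α y hy
  have h1 : killingForm K L ⁅(h : L), Δ e⁆ y = - (α h * killingForm K L (Δ e) y) := by
    rw [killingForm, traceForm_apply_lie_apply', lie_root hy, map_smul, smul_eq_mul]
  change killingForm K L (⁅(h : L), Δ e⁆ - β h • Δ e) y = 0
  rw [map_sub, LinearMap.sub_apply, h1, map_smul, LinearMap.smul_apply, smul_eq_mul]
  by_cases hab : α = -β
  · subst hab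
    simp
  · rw [horth α y hy hab]; simp

lemma der_of_kills {Δ : L →ₗ[K] L} (hΔ : IsLoc Δ) (hH : ∀ h ∈ H, Δ h = 0) (x y : L) :
    Δ ⁅x, y⁆ = ⁅Δ x, y⁆ + ⁅x, Δ y⁆ := by
  refine weight_ind (H := H) (p := fun x => Δ ⁅x, y⁆ = ⁅Δ x, y⁆ + ⁅x, Δ y⁆) (by simp)
    (fun a b ha hb => ?_) (fun β e he => ?_) x
  · simp only [add_lie, map_add, ha, hb]; abel
  refine weight_ind (H := H) (p := fun y => Δ ⁅e, y⁆ = ⁅Δ e, y⁆ + ⁅e, Δ y⁆) (by simp)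
    (fun a b ha hb => ?_) (fun α y hy => ?_) y
  · simp only [lie_add, map_add, ha, hb]; abel
  have hpe := preserves hΔ hH β he
  have hpy := preserves hΔ hH α hy
  by_cases hβ : β.IsZero
  · have heH := zero_or_mem hβ he
    rw [hH e heH, zero_lie, zero_add, lie_root hy ⟨e, heH⟩, lie_root hpy ⟨e, heH⟩, map_smul]
  let Δ₂ : L →ₗ[K] L := ((LieAlgebra.ad K L e) ∘ₗ Δ - Δ ∘ₗ (LieAlgebra.ad K L e))
    + LieAlgebra.ad K L (Δ e)
  have hn := LieAlgebra.isNilpotent_ad_of_mem_rootSpace H (χ := β) hβ he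
  have hl : IsLoc Δ₂ := (hΔ.comm e hn).add (isLoc_ad _)
  have hk : ∀ h ∈ H, Δ₂ h = 0 := by
    intro h hh
    simp only [Δ₂, LinearMap.add_apply, LinearMap.sub_apply, LinearMap.comp_apply,
      LieAlgebra.ad_apply, hH h hh, lie_zero]
    rw [← lie_skew e h, ← lie_skew (Δ e) h, lie_root he ⟨h, hh⟩, lie_root hpe ⟨h, hh⟩]
    simp
  have hm := preserves hl hk α hy
  have hval : Δ₂ y = ⁅e, Δ y⁆ - Δ ⁅e, y⁆ + ⁅Δ e, y⁆ := by
    simp [Δ₂]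
  have hmem : Δ₂ y ∈ rootSpace H (⇑β + ⇑α) := by
    rw [hval]
    refine add_mem (sub_mem (lie_mem_genWeightSpace_of_mem_genWeightSpace he hpy) ?_)
      (lie_mem_genWeightSpace_of_mem_genWeightSpace hpe hy)
    have hb : ⁅e, y⁆ ∈ rootSpace H (⇑β + ⇑α) := lie_mem_genWeightSpace_of_mem_genWeightSpace he hy
    by_cases hbot : rootSpace H (⇑β + ⇑α) = ⊥
    · rw [hbot, LieSubmodule.mem_bot] at hb
      rw [hb, map_zero]; exact zero_mem _
    · exact preserves hΔ hH ⟨⇑β + ⇑α, hbot⟩ hb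
  have hz : Δ₂ y = 0 := by
    by_contra hne
    apply hβ
    funext h
    have e1 := lie_root hm h
    have e2 := lie_root hmem h
    rw [e1] at e2
    have := smul_left_injective K hne e2
    simpa using this
  rw [hval] at hz
  rw [← sub_eq_zero, ← neg_eq_zero, ← hz]; abel

end

theorem semisimple_case {K L : Type*} [Field K] [CharZero K] [IsAlgClosed K] [LieRing L]
    [LieAlgebra K L] [IsKilling K L] [FiniteDimensional K L] (Δ : L →ₗ[K] L)
    (hΔ : ∀ x : L, ∃ D : LieDerivation K L L, Δ x = D x) (x y : L) :
    Δ ⁅x, y⁆ = ⁅Δ x, y⁆ + ⁅x, Δ y⁆ := by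
  obtain ⟨r, hr⟩ := LieAlgebra.exists_isCartanSubalgebra_engel K L
  set H := LieSubalgebra.engel K r
  have hin : ∀ x : L, ∃ a : L, Δ x = ⁅a, x⁆ := by
    intro x
    obtain ⟨D, hD⟩ := hΔ x
    obtain ⟨a, rfl⟩ := LieDerivation.IsKilling.exists_eq_ad D
    exact ⟨a, by simpa using hD⟩
  have hloc : IsLoc Δ := by
    intro x y hxy
    obtain ⟨a, ha⟩ := hin x
    rw [ha]
    exact isLoc_ad a x y hxy
  obtain ⟨h0, hh0⟩ := Module.Dual.exists_forall_ne_zero_of_forall_exists (K := K) (M := H)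
    (fun α : {α : Weight K H L // α.IsNonZero} => Weight.toLinear K H L α.1) (by
      rintro ⟨α, hα⟩
      by_contra! hc
      exact hα (funext fun h => by simpa using hc h))
  obtain ⟨a, ha⟩ := hin h0
  let Δ' : L →ₗ[K] L := Δ + LieAlgebra.ad K L (-a)
  have hloc' : IsLoc Δ' := hloc.add (isLoc_ad _)
  have hz0 : Δ' h0 = 0 := by
    simp only [Δ', LinearMap.add_apply, ha, LieAlgebra.ad_apply, neg_lie, add_neg_cancel]
  have hH : ∀ h ∈ H, Δ' h = 0 := by
    intro h hh
    apply eq_zero_of_orth (H := H)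
    intro α y hy
    by_cases hα : α.IsZero
    · apply hloc'
      rw [lie_root hy ⟨h, hh⟩, show (α : H → K) = 0 from hα]; simp
    · have hne : α h0 ≠ 0 := by simpa using hh0 ⟨α, hα⟩
      have := hloc' (h - (α ⟨h, hh⟩ * (α h0)⁻¹) • (h0 : L)) y (by
        rw [sub_lie, smul_lie, lie_root hy ⟨h, hh⟩, lie_root hy h0, smul_smul, mul_assoc,
          inv_mul_cancel₀ hne, mul_one, sub_self])
      simpa [hz0] using this
  have := der_of_kills hloc' hH x y
  simp only [Δ', LinearMap.add_apply, LieAlgebra.ad_apply, neg_lie, add_lie, lie_add, lie_neg,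
    leibniz_lie a x y] at this
  rw [← sub_eq_zero] at this ⊢
  rw [← this]; abel

end LocDer

theorem localDerivation_isDerivation_of_locallySemisimple (F : Type*) [Field F]
    [IsAlgClosed F] [CharZero F] (L : Type*) [LieRing L] [LieAlgebra F L]
    (hloc : ∀ S : Finset L, ∃ (H : LieSubalgebra F L) (π : L →ₗ[F] L),
      (S : Set L) ⊆ (H : Set L) ∧ FiniteDimensional F H ∧ LieAlgebra.IsSemisimple F H ∧
      (∀ x : L, π x ∈ H) ∧ (∀ x ∈ H, π x = x) ∧
      (∀ D : LieDerivation F L L,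
        ∃ D' : LieDerivation F H H, ∀ x : H, (D' x : L) = π (D x)))
    (Δ : L →ₗ[F] L) (hΔ : ∀ x : L, ∃ D : LieDerivation F L L, Δ x = D x) :
    ∃ D : LieDerivation F L L, ⇑Δ = ⇑D := by
  classical
  have main : ∀ x y : L, Δ ⁅x, y⁆ = ⁅x, Δ y⁆ - ⁅y, Δ x⁆ := by
    intro x y
    obtain ⟨H, π, hS, hfd, hss, hπ, hid, hder⟩ := hloc {x, y, Δ x, Δ y, Δ ⁅x, y⁆}
    have hx : x ∈ H := hS (by simp)
    have hy : y ∈ H := hS (by simp)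
    have hDx : Δ x ∈ H := hS (by simp)
    have hDy : Δ y ∈ H := hS (by simp)
    have hDxy : Δ ⁅x, y⁆ ∈ H := hS (by simp)
    let Δ' : H →ₗ[F] H := (π ∘ₗ Δ ∘ₗ H.toSubmodule.subtype).codRestrict H.toSubmodule
      (fun v => hπ _)
    have hval : ∀ v : H, ((Δ' v : H) : L) = π (Δ v) := fun v => rfl
    have key := LocDer.semisimple_case Δ' (fun v => by
      obtain ⟨D, hD⟩ := hΔ v
      obtain ⟨D', hD'⟩ := hder D
      refine ⟨D', Subtype.ext ?_⟩
      rw [hval, hD, hD']) ⟨x, hx⟩ ⟨y, hy⟩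
    have key2 := congrArg (Subtype.val) key
    change π (Δ ⁅x, y⁆) = ⁅π (Δ x), y⁆ + ⁅x, π (Δ y)⁆ at key2
    rw [hid _ hDxy, hid _ hDx, hid _ hDy] at key2
    rw [key2, ← lie_skew y (Δ x)]
    abel
  exact ⟨⟨Δ, main⟩, rfl⟩
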